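/- Let F be an infinite field. For every nonnegative integer n, the Krull dimension of the polynomial ring F[t_1,…,t_n] equals n. -/

import Mathlib

/-- Let `F` be an infinite field.  For every nonnegative integer `n`, the Krull dimension
of the polynomial ring `F[t_1,…,t_n]` equals `n`. -/
theorem stmt_13 (F : Type*) [Field F] [Infinite F] (n : ℕ) :
    ringKrullDim (MvPolynomial (Fin n) F) = n := by
  rw [MvPolynomial.ringKrullDim_of_isNoetherianRing, ringKrullDim_eq_zero_of_field]
  simp
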